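/- Let K be a commutative semiring, m ≥ 2, w ≥ 2, 1 ≤ r ≤ w−1, and 1 ≤ k, ℓ ≤ m. Set L = (w−1)m + ((ℓ−k) mod m) + 1 and L₅ = (r−1)m + (m−k+1). Take fresh elements σ₁, …, σ_m with weights s₁, …, s_m, and a chain c₁, …, c_L where c_j carries the weight s_{((k+j−2) mod m)+1} (so the chain runs cyclically through the spoke weights starting at s_k and ending at s_ℓ; the element c_{L₅} carries weight s_m and c_{L₅+1} carries weight s₁). Let A, B, D be finite posets with distinguished elements a ∈ A, b ∈ B, d ∈ D. Define six configurations by generating relations (always including the orders of the tail posets involved): P₁ on A ∪ {c₁, …, c_L} ∪ B with c₁ ≺ c₂ ≺ ⋯ ≺ c_L, c₁ ≺ a, and b ≺ c_L; P₂ on {σ's} ∪ D with σ₁ ≺ σ₂ ≺ ⋯ ≺ σ_m, σ₁ ≺ d, and d ≺ σ_m; P₃ on {c_{L₅+1}, …, c_L} ∪ D ∪ B with c_{L₅+1} ≺ ⋯ ≺ c_L, c_{L₅+1} ≺ d, and b ≺ c_L; P₄ on {σ's} ∪ A with the cyclic chain σ_k ≺ σ_{k+1} ≺ ⋯ ≺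 σ_{k−1} (all m spokes, indices modulo m in {1, …, m}), σ_k ≺ a, and a ≺ σ_{k−1}; P₅ on A ∪ {c₁, …, c_{L₅}} ∪ D with c₁ ≺ ⋯ ≺ c_{L₅}, c₁ ≺ a, and d ≺ c_{L₅}; P₆ on {σ's} ∪ B with the cyclic chain σ_{ℓ+1} ≺ σ_{ℓ+2} ≺ ⋯ ≺ σ_ℓ (all m spokes, indices modulo m), σ_{ℓ+1} ≺ b, and b ≺ σ_ℓ. Let Y = ∏_{j=L₅+1}^{L} s_{((k+j−2) mod m)+1}. Then Z(P₁) · Z(P₂) = Z(P₃) · Z(P₄) + Y · Z(P₅) · Z(P₆). -/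

import Mathlib

/-!
The combinatorial content of the second (notched) formula of Proposition 5.2 of the
paper (Type 1 grafting), in the down-set formalism: an arc `γ₁` winds `w − 1` times
around a puncture `p` with spokes `σ₁, …, σ_m`, crossing the ascending chain of spokes
recorded by `c₁, …, c_L` (with cyclic weights starting at `s_k` and ending at `s_ℓ`)
between its tails `A` and `B`, while `γ₂^{(p)}` is notched at `p`; resolving the `r`-th
intersection gives
`Z(P₁) · Z(P₂) = Z(P₃) · Z(P₄) + Y · Z(P₅) · Z(P₆)`
with `Y = ∏_{j=L₅+1}^{L} s_{((k+j−2) mod m)+1}`.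
(The winding number `w` of the statement is called `W` here, to avoid a clash with the
weight functions.)
-/

attribute [local instance] Classical.propDecidable

noncomputable section

/-- The ideal sum of a configuration: the sum, over all down-sets `S` of the ground set
(`S ⊆ ground`, closed under the generating relations: `rel x y` with `x ∈ ground` and
`y ∈ S` implies `x ∈ S`), of the product of the weights of the elements of `S`. -/
def idealSum {α K : Type*} [CommSemiring K]
    (ground : Finset α) (rel : α → α → Prop) (w : α → K) : K :=
  ∑ S ∈ ground.powerset.filter
      (fun S => ∀ x ∈ ground, ∀ y ∈ S, rel x y → x ∈ S),
    ∏ x ∈ S, w x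

/-- The generating chain `f lo ≺ f (lo+1) ≺ ⋯ ≺ f hi`. -/
def chainRel {α : Type*} (f : ℕ → α) (lo hi : ℕ) : α → α → Prop :=
  fun p q => ∃ i, lo ≤ i ∧ i + 1 ≤ hi ∧ p = f i ∧ q = f (i + 1)

/-- The single generating relation `u ≺ v`. -/
def covRel {α : Type*} (u v : α) : α → α → Prop := fun p q => p = u ∧ q = v

/-- The order of a poset `P`, transported along `f`. -/
def posetRel {P α : Type*} [PartialOrder P] (f : P → α) : α → α → Prop :=
  fun p q => ∃ x y : P, x ≤ y ∧ p = f x ∧ q = f y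

/-- The elements `f lo, …, f hi`. -/
def natGround {α : Type*} (f : ℕ → α) (lo hi : ℕ) : Finset α := (Finset.Icc lo hi).image f

/-- All the elements of the finite poset `P`, transported along `f`. -/
def posetGround {P α : Type*} [Fintype P] (f : P → α) : Finset α := Finset.univ.image f

/-- Embedding of the tail poset `A`. -/
def eA (A B D : Type*) : A → A ⊕ (B ⊕ (D ⊕ (ℕ ⊕ ℕ))) := Sum.inl

/-- Embedding of the tail poset `B`. -/
def eB (A B D : Type*) : B → A ⊕ (B ⊕ (D ⊕ (ℕ ⊕ ℕ))) := fun y => Sum.inr (Sum.inl y)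

/-- Embedding of the tail poset `D`. -/
def eD (A B D : Type*) : D → A ⊕ (B ⊕ (D ⊕ (ℕ ⊕ ℕ))) :=
  fun y => Sum.inr (Sum.inr (Sum.inl y))

/-- The spokes `σ₁, …, σ_m`. -/
def eS (A B D : Type*) : ℕ → A ⊕ (B ⊕ (D ⊕ (ℕ ⊕ ℕ))) :=
  fun i => Sum.inr (Sum.inr (Sum.inr (Sum.inl i)))

/-- The chain elements `c₁, …, c_L`. -/
def eC (A B D : Type*) : ℕ → A ⊕ (B ⊕ (D ⊕ (ℕ ⊕ ℕ))) :=
  fun j => Sum.inr (Sum.inr (Sum.inr (Sum.inr j)))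

/-- The contribution of a chain with weights `g 0, …, g M`: the terms of the empty, the
intermediate and the full initial segments carry the coefficients `x`, `y` and `z`. -/
def chainSum {K : Type*} [CommSemiring K] (g : ℕ → K) (M : ℕ) (x y z : K) : K :=
  x + (∑ n ∈ Finset.range M, ∏ j ∈ Finset.range (n + 1), g j) * y +
    (∏ j ∈ Finset.range (M + 1), g j) * z

theorem chainSum_congr {K : Type*} [CommSemiring K] (g g' : ℕ → K) (M : ℕ) (x y z : K)
    (h : ∀ j ≤ M, g j = g' j) : chainSum g M x y z = chainSum g' M x y z := by
  have hprod : ∀ n ≤ M + 1, ∏ j ∈ Finset.range n, g j = ∏ j ∈ Finset.range n, g' j :=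
    fun n hn => Finset.prod_congr rfl fun j hj => h j (by have := Finset.mem_range.1 hj; omega)
  have hsum : ∑ n ∈ Finset.range M, ∏ j ∈ Finset.range (n + 1), g j =
      ∑ n ∈ Finset.range M, ∏ j ∈ Finset.range (n + 1), g' j :=
    Finset.sum_congr rfl fun n hn => hprod _ (by have := Finset.mem_range.1 hn; omega)
  rw [chainSum, chainSum, hsum, hprod _ le_rfl]

theorem map_chainSum {R K : Type*} [CommSemiring R] [CommSemiring K] (φ : R →+* K)
    (g : ℕ → R) (M : ℕ) (x y z : R) :
    φ (chainSum g M x y z) = chainSum (fun j => φ (g j)) M (φ x) (φ y) (φ z) := by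
  simp [chainSum]

/-- The sum of the first `a + n` partial products of `g` splits at `a`. -/
theorem sum_prod_range_add {K : Type*} [CommSemiring K] (g : ℕ → K) (a n : ℕ) :
    ∑ i ∈ Finset.range (a + n), ∏ j ∈ Finset.range i, g j =
      ∑ i ∈ Finset.range a, ∏ j ∈ Finset.range i, g j +
        (∏ j ∈ Finset.range a, g j) *
          ∑ i ∈ Finset.range n, ∏ j ∈ Finset.range i, g (a + j) := by
  rw [Finset.sum_range_add, Finset.mul_sum]
  simp only [Finset.prod_range_add]

theorem sum_prod_range_succ {K : Type*} [CommSemiring K] (g : ℕ → K) (n : ℕ) :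
    ∑ i ∈ Finset.range (n + 1), ∏ j ∈ Finset.range i, g j =
      ∑ i ∈ Finset.range n, ∏ j ∈ Finset.range (i + 1), g j + 1 := by
  rw [Finset.sum_range_succ']
  simp

/-- The product of a periodic function over a full period does not depend on its start. -/
theorem prod_range_period {K : Type*} [CommSemiring K] (g : ℕ → K) (m : ℕ)
    (hg : Function.Periodic g m) (o : ℕ) :
    ∏ j ∈ Finset.range m, g (o + j) = ∏ j ∈ Finset.range m, g j := by
  induction o with
  | zero => simp
  | succ o ih =>
    rw [← ih]
    cases m with
    | zero => simp
    | succ m =>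
      rw [Finset.prod_range_succ, Finset.prod_range_succ']
      congr 1
      · exact Finset.prod_congr rfl fun j _ => congrArg g (by ring)
      · rw [show o + 1 + m = o + 0 + (m + 1) by ring]
        exact hg _

/-- The two ways of splitting `a + m` partial products of an `m`-periodic function. -/
theorem sum_prod_range_period {K : Type*} [CommSemiring K] (g : ℕ → K) (m : ℕ)
    (hg : Function.Periodic g m) (o a : ℕ) :
    ∑ i ∈ Finset.range m, ∏ j ∈ Finset.range i, g (o + j) +
        (∏ j ∈ Finset.range m, g j) *
          ∑ i ∈ Finset.range a, ∏ j ∈ Finset.range i, g (o + j) =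
      ∑ i ∈ Finset.range a, ∏ j ∈ Finset.range i, g (o + j) +
        (∏ j ∈ Finset.range a, g (o + j)) *
          ∑ i ∈ Finset.range m, ∏ j ∈ Finset.range i, g (o + a + j) := by
  have h1 := sum_prod_range_add (fun j => g (o + j)) m a
  have h2 := sum_prod_range_add (fun j => g (o + j)) a m
  rw [add_comm a m, h1, prod_range_period g m hg] at h2
  have h3 : ∀ j, g (o + (m + j)) = g (o + j) := fun j => by
    rw [show o + (m + j) = o + j + m by ring]; exact hg _
  simp only [h3] at h2
  simpa only [← add_assoc] using h2

theorem chainSum_grafting_of_isCancelAdd {K : Type*} [CommSemiring K] [IsCancelAdd K]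
    (g : ℕ → K) (m : ℕ) (hg : Function.Periodic g (m + 1)) (o a n : ℕ)
    (A₀ A₁ B₀ B₁ D₀ D₁ : K) :
    chainSum (fun j => g (o + j)) (a + 1 + n) (A₀ * (B₀ + B₁)) ((A₀ + A₁) * (B₀ + B₁))
          ((A₀ + A₁) * B₁) *
        chainSum (fun j => g (o + (a + 1) + j)) m D₀ (D₀ + D₁) D₁ =
      chainSum (fun j => g (o + (a + 1) + j)) n (D₀ * (B₀ + B₁)) ((D₀ + D₁) * (B₀ + B₁))
            ((D₀ + D₁) * B₁) *
          chainSum (fun j => g (o + j)) m A₀ (A₀ + A₁) A₁ +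
        (∏ j ∈ Finset.range (n + 1), g (o + (a + 1) + j)) *
          (chainSum (fun j => g (o + j)) a (A₀ * (D₀ + D₁)) ((A₀ + A₁) * (D₀ + D₁))
              ((A₀ + A₁) * D₁) *
            chainSum (fun j => g (o + (a + 1) + (n + 1) + j)) m B₀ (B₀ + B₁) B₁) := by
  have h1 := sum_prod_range_add (fun j => g (o + j)) (a + 1) (n + 1)
  have h2 := sum_prod_range_period g (m + 1) hg o (a + 1)
  have h3 := sum_prod_range_period g (m + 1) hg (o + (a + 1)) (n + 1)
  have hp := Finset.prod_range_add (fun j => g (o + j)) (a + 1) (n + 1)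
  simp only [← add_assoc (a + 1) n 1, sum_prod_range_succ] at h1 h2 h3 hp
  simp only [← add_assoc o] at h1 h2 h3 hp ⊢
  simp only [chainSum, hp, prod_range_period g (m + 1) hg]
  generalize ∑ i ∈ Finset.range (a + 1 + n), ∏ j ∈ Finset.range (i + 1), g (o + j) = tL at *
  generalize ∑ i ∈ Finset.range a, ∏ j ∈ Finset.range (i + 1), g (o + j) = ta at *
  generalize ∑ i ∈ Finset.range m, ∏ j ∈ Finset.range (i + 1), g (o + j) = tm at *
  generalize ∑ i ∈ Finset.range n, ∏ j ∈ Finset.range (i + 1), g (o + a + 1 + j) = un at *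
  generalize ∑ i ∈ Finset.range m, ∏ j ∈ Finset.range (i + 1), g (o + a + 1 + j) = um at *
  generalize ∑ i ∈ Finset.range m, ∏ j ∈ Finset.range (i + 1), g (o + a + 1 + n + 1 + j) = vm
    at *
  generalize ∏ j ∈ Finset.range (a + 1), g (o + j) = p at *
  generalize ∏ j ∈ Finset.range (n + 1), g (o + a + 1 + j) = y at *
  generalize ∏ j ∈ Finset.range (m + 1), g j = q at *
  linear_combination
    h1 * ((A₀ + A₁) * (B₀ + B₁) * (D₀ + um * (D₀ + D₁) + q * D₁)) +
    h2 * ((A₀ + A₁) * (B₀ + B₁) * D₁) +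
    h2.symm * ((un + 1) * (A₀ + A₁) * (B₀ + B₁) * (D₀ + D₁) +
      y * (A₀ + A₁) * B₁ * (D₀ + D₁)) +
    h3.symm * (A₁ * (B₀ + B₁) * (D₀ + D₁)) +
    h3 * ((ta + 1) * (A₀ + A₁) * (B₀ + B₁) * (D₀ + D₁) + p * (A₀ + A₁) * (B₀ + B₁) * D₁)

/-- Transfer of `chainSum_grafting_of_isCancelAdd` from polynomials with natural number
coefficients to an arbitrary commutative semiring. -/
theorem chainSum_grafting {K : Type*} [CommSemiring K]
    (s : ℕ → K) (m o a n : ℕ) (A₀ A₁ B₀ B₁ D₀ D₁ : K) :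
    chainSum (fun j => s ((o + j) % (m + 1))) (a + 1 + n) (A₀ * (B₀ + B₁))
          ((A₀ + A₁) * (B₀ + B₁)) ((A₀ + A₁) * B₁) *
        chainSum (fun j => s ((o + (a + 1) + j) % (m + 1))) m D₀ (D₀ + D₁) D₁ =
      chainSum (fun j => s ((o + (a + 1) + j) % (m + 1))) n (D₀ * (B₀ + B₁))
            ((D₀ + D₁) * (B₀ + B₁)) ((D₀ + D₁) * B₁) *
          chainSum (fun j => s ((o + j) % (m + 1))) m A₀ (A₀ + A₁) A₁ +
        (∏ j ∈ Finset.range (n + 1), s ((o + (a + 1) + j) % (m + 1))) *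
          (chainSum (fun j => s ((o + j) % (m + 1))) a (A₀ * (D₀ + D₁))
              ((A₀ + A₁) * (D₀ + D₁)) ((A₀ + A₁) * D₁) *
            chainSum (fun j => s ((o + (a + 1) + (n + 1) + j) % (m + 1))) m
              B₀ (B₀ + B₁) B₁) := by
  have h := chainSum_grafting_of_isCancelAdd (K := MvPolynomial (ℕ ⊕ Fin 6) ℕ)
    (fun x => MvPolynomial.X (Sum.inl (x % (m + 1)))) m (fun x => by simp) o a n
    (.X (.inr 0)) (.X (.inr 1)) (.X (.inr 2)) (.X (.inr 3)) (.X (.inr 4)) (.X (.inr 5))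
  have hK := congrArg (MvPolynomial.eval₂Hom (Nat.castRingHom K)
    (Sum.elim s ![A₀, A₁, B₀, B₁, D₀, D₁])) h
  simpa only [map_add, map_mul, map_prod, map_chainSum, MvPolynomial.coe_eval₂Hom,
    MvPolynomial.eval₂_X, Sum.elim_inl, Sum.elim_inr, Matrix.cons_val] using hK

/-- The ideal sum restricted to the down-sets satisfying `φ`. -/
def restrictedIdealSum {α K : Type*} [CommSemiring K]
    (ground : Finset α) (rel : α → α → Prop) (w : α → K) (φ : Finset α → Prop) : K :=
  ∑ S ∈ ground.powerset with (∀ x ∈ ground, ∀ y ∈ S, rel x y → x ∈ S) ∧ φ S, ∏ x ∈ S, w x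

theorem restrictedIdealSum_true {α K : Type*} [CommSemiring K]
    (G : Finset α) (R : α → α → Prop) (w : α → K) (u : α) :
    restrictedIdealSum G R w (fun _ => True) =
      restrictedIdealSum G R w (fun S => u ∉ S) + restrictedIdealSum G R w (fun S => u ∈ S) := by
  simp only [restrictedIdealSum, ← Finset.filter_filter, and_true]
  rw [add_comm, Finset.sum_filter_add_sum_filter_not]

theorem restrictedIdealSum_union {α K : Type*} [CommSemiring K]
    (G H : Finset α) (R R' : α → α → Prop) (w : α → K) (φ φ₁ φ₂ : Finset α → Prop)
    (hGH : Disjoint G H) (hR : ∀ x y, R x y → x ∈ G ∧ y ∈ G)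
    (hR' : ∀ x y, R' x y → x ∈ H ∧ y ∈ H)
    (hφ : ∀ U ⊆ G, ∀ V ⊆ H, (φ (U ∪ V) ↔ φ₁ U ∧ φ₂ V)) :
    restrictedIdealSum (G ∪ H) (R ⊔ R') w φ =
      restrictedIdealSum G R w φ₁ * restrictedIdealSum H R' w φ₂ := by
  have hdown : ∀ U ⊆ G, ∀ V ⊆ H,
      ((∀ x ∈ G ∪ H, ∀ y ∈ U ∪ V, (R ⊔ R') x y → x ∈ U ∪ V) ↔
        (∀ x ∈ G, ∀ y ∈ U, R x y → x ∈ U) ∧ ∀ x ∈ H, ∀ y ∈ V, R' x y → x ∈ V) := by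
    intro U hU V hV
    simp only [Pi.sup_apply, sup_Prop_eq, Finset.mem_union]
    have := Finset.disjoint_left.1 hGH
    grind
  rw [restrictedIdealSum, restrictedIdealSum, restrictedIdealSum, Finset.sum_mul_sum,
    ← Finset.sum_product']
  symm
  refine Finset.sum_bij (fun p _ => p.1 ∪ p.2) ?_ ?_ ?_ ?_
  · rintro ⟨U, V⟩ h
    simp only [Finset.mem_product, Finset.mem_filter, Finset.mem_powerset] at h ⊢
    exact ⟨Finset.union_subset_union h.1.1 h.2.1, (hdown U h.1.1 V h.2.1).2 ⟨h.1.2.1, h.2.2.1⟩,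
      (hφ U h.1.1 V h.2.1).2 ⟨h.1.2.2, h.2.2.2⟩⟩
  · rintro ⟨U, V⟩ h ⟨U', V'⟩ h' e
    simp only [Finset.mem_product, Finset.mem_filter, Finset.mem_powerset] at h h'
    have := Finset.disjoint_left.1 hGH
    simp only [Finset.ext_iff, Finset.subset_iff, Finset.mem_union, Prod.mk.injEq] at *
    grind
  · intro S hS
    simp only [Finset.mem_filter, Finset.mem_powerset] at hS
    have e : S ∩ G ∪ S ∩ H = S := by
      rw [← Finset.inter_union_distrib_left, Finset.inter_eq_left.2 hS.1]
    have h1 := hdown _ (S.inter_subset_right (s₂ := G)) _ (S.inter_subset_right (s₂ := H))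
    have h2 := hφ _ (S.inter_subset_right (s₂ := G)) _ (S.inter_subset_right (s₂ := H))
    rw [e] at h1 h2
    refine ⟨(S ∩ G, S ∩ H), ?_, e⟩
    simp only [Finset.mem_product, Finset.mem_filter, Finset.mem_powerset]
    exact ⟨⟨Finset.inter_subset_right, (h1.1 hS.2.1).1, (h2.1 hS.2.2).1⟩,
      Finset.inter_subset_right, (h1.1 hS.2.1).2, (h2.1 hS.2.2).2⟩
  · rintro ⟨U, V⟩ h
    simp only [Finset.mem_product, Finset.mem_filter, Finset.mem_powerset] at h
    exact (Finset.prod_union (hGH.mono h.1.1 h.2.1)).symm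

/-- A predicate on `{0, …, N - 1}` closed under predecessors is an initial segment. -/
theorem exists_initial_segment (p : ℕ → Prop) (N : ℕ) (h : ∀ i, i + 1 < N → p (i + 1) → p i) :
    ∃ n ≤ N, ∀ i < N, (p i ↔ i < n) := by
  induction N with
  | zero => exact ⟨0, le_rfl, by simp⟩
  | succ N ih =>
    obtain ⟨n, hn, hp⟩ := ih fun i hi => h i (by omega)
    by_cases hN : p N
    · refine ⟨N + 1, le_rfl, fun i hi => iff_of_true ?_ hi⟩
      exact Nat.decreasingInduction' (P := p) (fun k hk _ => h k (by omega))
        (Nat.lt_succ_iff.1 hi) hN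
    · refine ⟨n, by omega, fun i hi => ?_⟩
      rcases Nat.lt_succ_iff_lt_or_eq.1 hi with hi | rfl
      · exact hp i hi
      · exact iff_of_false hN (by omega)

/-- The ideal sum of a configuration consisting of a chain `f 0 ≺ ⋯ ≺ f M` and of a
configuration `G`, linked by `f 0 ≺ u` and `v ≺ f M` with `u, v ∈ G`. -/
theorem idealSum_chain {α K : Type*} [CommSemiring K]
    (ground : Finset α) (rel : α → α → Prop) (w : α → K) (f : ℕ → α) (M : ℕ)
    (G : Finset α) (R : α → α → Prop) (u v : α) (hu : u ∈ G) (hv : v ∈ G)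
    (hR : ∀ x y, R x y → x ∈ G ∧ y ∈ G) (hf : ∀ i ≤ M, ∀ j ≤ M, f i = f j → i = j)
    (hfG : ∀ i ≤ M, f i ∉ G)
    (hground : ∀ x, x ∈ ground ↔ (∃ i ≤ M, x = f i) ∨ x ∈ G)
    (hrel : ∀ x y, rel x y ↔ (∃ i < M, x = f i ∧ y = f (i + 1)) ∨ R x y ∨
      (x = f 0 ∧ y = u) ∨ (x = v ∧ y = f M)) :
    idealSum ground rel w =
      chainSum (fun j => w (f j)) M (restrictedIdealSum G R w (fun S => u ∉ S))
        (restrictedIdealSum G R w (fun _ => True))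
        (restrictedIdealSum G R w (fun S => v ∈ S)) := by
  let c : ℕ → Finset α := fun n => (Finset.range n).image f
  have hcf : ∀ n ≤ M + 1, ∀ i ≤ M, (f i ∈ c n ↔ i < n) := by
    intro n hn i hi
    simp only [c, Finset.mem_image, Finset.mem_range]
    exact ⟨fun ⟨j, hj, e⟩ => hf j (by omega) i hi e ▸ hj, fun h => ⟨i, h, rfl⟩⟩
  have hcG : ∀ n ≤ M + 1, ∀ x ∈ G, x ∉ c n := by
    intro n hn x hx h
    simp only [c, Finset.mem_image, Finset.mem_range] at h
    obtain ⟨j, hj, rfl⟩ := h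
    exact hfG j (by omega) hx
  have hdown : ∀ n ≤ M + 1, ∀ V ⊆ G,
      ((∀ x ∈ ground, ∀ y ∈ c n ∪ V, rel x y → x ∈ c n ∪ V) ↔
        (∀ x ∈ G, ∀ y ∈ V, R x y → x ∈ V) ∧ (n = 0 → u ∉ V) ∧ (n = M + 1 → v ∈ V)) := by
    intro n hn V hV
    have hF : ∀ i ≤ M, (f i ∈ c n ∪ V ↔ i < n) := fun i hi => by
      rw [Finset.mem_union, hcf n hn i hi]
      exact or_iff_left fun h => hfG i hi (hV h)
    have hG : ∀ x ∈ G, (x ∈ c n ∪ V ↔ x ∈ V) := fun x hx => by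
      rw [Finset.mem_union]
      exact or_iff_right (hcG n hn x hx)
    constructor
    · intro h
      refine ⟨fun x hx y hy hxy => ?_, ?_, ?_⟩
      · exact (hG x hx).1 (h x ((hground x).2 (.inr hx)) y (Finset.mem_union_right _ hy)
          ((hrel x y).2 (.inr (.inl hxy))))
      · rintro rfl huV
        have := h (f 0) ((hground _).2 (.inl ⟨0, by omega, rfl⟩)) u
          (Finset.mem_union_right _ huV) ((hrel _ _).2 (.inr (.inr (.inl ⟨rfl, rfl⟩))))
        exact absurd ((hF 0 (by omega)).1 this) (by omega)
      · rintro rfl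
        exact (hG v hv).1 (h v ((hground _).2 (.inr hv)) (f M) ((hF M le_rfl).2 (by omega))
          ((hrel _ _).2 (.inr (.inr (.inr ⟨rfl, rfl⟩)))))
    · rintro ⟨h1, h2, h3⟩ x hx y hy hxy
      rcases (hrel x y).1 hxy with ⟨i, hi, rfl, rfl⟩ | h | ⟨rfl, rfl⟩ | ⟨rfl, rfl⟩
      · rw [hF _ (by omega)] at hy ⊢
        omega
      · obtain ⟨hx, hyG⟩ := hR x y h
        rw [hG _ hyG] at hy
        exact (hG x hx).2 (h1 x hx y hy h)
      · rw [hG _ hu] at hy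
        rw [hF _ (by omega)]
        by_contra h0
        exact h2 (by omega) hy
      · rw [hF _ le_rfl] at hy
        exact (hG _ hv).2 (h3 (by omega))
  have hsum : idealSum ground rel w = ∑ n ∈ Finset.range (M + 2),
      (∏ j ∈ Finset.range n, w (f j)) *
        restrictedIdealSum G R w (fun S => (n = 0 → u ∉ S) ∧ (n = M + 1 → v ∈ S)) := by
    simp only [idealSum, restrictedIdealSum, Finset.mul_sum]
    rw [Finset.sum_sigma']
    symm
    refine Finset.sum_bij (fun p _ => c p.1 ∪ p.2) ?_ ?_ ?_ ?_
    · rintro ⟨n, V⟩ h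
      simp only [Finset.mem_sigma, Finset.mem_range, Finset.mem_filter,
        Finset.mem_powerset] at h ⊢
      refine ⟨fun x hx => (hground x).2 ?_, (hdown n (by omega) V h.2.1).2 h.2.2⟩
      rcases Finset.mem_union.1 hx with hx | hx
      · simp only [c, Finset.mem_image, Finset.mem_range] at hx
        obtain ⟨j, hj, rfl⟩ := hx
        exact .inl ⟨j, by omega, rfl⟩
      · exact .inr (h.2.1 hx)
    · rintro ⟨n, V⟩ h ⟨n', V'⟩ h' e
      simp only [Finset.mem_sigma, Finset.mem_range, Finset.mem_filter,
        Finset.mem_powerset] at h h'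
      have hn : n = n' := by
        have key : ∀ i ≤ M, (i < n ↔ i < n') := fun i hi => by
          have := Finset.ext_iff.1 e (f i)
          simp only [Finset.mem_union, hcf n (by omega) i hi, hcf n' (by omega) i hi] at this
          have h3 : f i ∉ V := fun h4 => hfG i hi (h.2.1 h4)
          have h4 : f i ∉ V' := fun h4 => hfG i hi (h'.2.1 h4)
          tauto
        by_contra hne
        rcases Nat.lt_or_gt_of_ne hne with hlt | hlt
        · have := key n (by omega); omega
        · have := key n' (by omega); omega
      subst hn
      have hV : V = V' := by
        ext x
        by_cases hx : x ∈ G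
        · have := Finset.ext_iff.1 e x
          simpa [hcG n (by omega) x hx] using this
        · exact iff_of_false (fun h4 => hx (h.2.1 h4)) (fun h4 => hx (h'.2.1 h4))
      rw [hV]
    · intro S hS
      simp only [Finset.mem_filter, Finset.mem_powerset] at hS
      obtain ⟨n, hn, hp⟩ := exists_initial_segment (fun i => f i ∈ S) (M + 1) fun i hi h =>
        hS.2 (f i) ((hground _).2 (.inl ⟨i, by omega, rfl⟩)) _ h
          ((hrel _ _).2 (.inl ⟨i, by omega, rfl, rfl⟩))
      have e : c n ∪ S ∩ G = S := by
        ext x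
        rw [Finset.mem_union, Finset.mem_inter]
        constructor
        · rintro (hx | hx)
          · simp only [c, Finset.mem_image, Finset.mem_range] at hx
            obtain ⟨j, hj, rfl⟩ := hx
            exact (hp j (by omega)).2 hj
          · exact hx.1
        · intro hx
          rcases (hground x).1 (hS.1 hx) with ⟨i, hi, rfl⟩ | hG
          · exact .inl ((hcf n hn i hi).2 ((hp i (by omega)).1 hx))
          · exact .inr ⟨hx, hG⟩
      refine ⟨⟨n, S ∩ G⟩, ?_, e⟩
      simp only [Finset.mem_sigma, Finset.mem_range, Finset.mem_filter, Finset.mem_powerset]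
      exact ⟨by omega, Finset.inter_subset_right,
        (hdown n hn _ Finset.inter_subset_right).1 (by rw [e]; exact hS.2)⟩
    · rintro ⟨n, V⟩ h
      simp only [Finset.mem_sigma, Finset.mem_range, Finset.mem_filter,
        Finset.mem_powerset] at h
      rw [Finset.prod_union, Finset.prod_image]
      · intro i hi j hj e
        simp only [Finset.coe_range, Set.mem_Iio] at hi hj
        exact hf i (by omega) j (by omega) e
      · exact Finset.disjoint_left.2 fun x hx hV => hcG n (by omega) x (h.2.1 hV) hx
  rw [hsum, Finset.sum_range_succ, Finset.sum_range_succ', chainSum, Finset.sum_mul]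
  have hmid : ∀ n ∈ Finset.range M, (∏ j ∈ Finset.range (n + 1), w (f j)) *
      restrictedIdealSum G R w (fun S => (n + 1 = 0 → u ∉ S) ∧ (n + 1 = M + 1 → v ∈ S)) =
      (∏ j ∈ Finset.range (n + 1), w (f j)) * restrictedIdealSum G R w (fun _ => True) := by
    intro n hn
    have := (Finset.mem_range.1 hn).ne
    simp [this]
  rw [Finset.sum_congr rfl hmid]
  simp [add_comm]

/-- The ideal sum of a chain with one tail attached to both of its ends. -/
theorem idealSum_loop {α K P : Type*} [CommSemiring K] [Fintype P] [PartialOrder P]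
    (ground : Finset α) (rel : α → α → Prop) (w : α → K) (f : ℕ → α) (M : ℕ)
    (e : P → α) (u : P)
    (hf : ∀ i ≤ M, ∀ j ≤ M, f i = f j → i = j) (hfe : ∀ i ≤ M, ∀ x, f i ≠ e x)
    (hground : ∀ x, x ∈ ground ↔ (∃ i ≤ M, x = f i) ∨ x ∈ posetGround e)
    (hrel : ∀ x y, rel x y ↔ (∃ i < M, x = f i ∧ y = f (i + 1)) ∨ posetRel e x y ∨
      (x = f 0 ∧ y = e u) ∨ (x = e u ∧ y = f M)) :
    idealSum ground rel w =
      chainSum (fun j => w (f j)) M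
        (restrictedIdealSum (posetGround e) (posetRel e) w (fun S => e u ∉ S))
        (restrictedIdealSum (posetGround e) (posetRel e) w (fun S => e u ∉ S) +
          restrictedIdealSum (posetGround e) (posetRel e) w (fun S => e u ∈ S))
        (restrictedIdealSum (posetGround e) (posetRel e) w (fun S => e u ∈ S)) := by
  rw [← restrictedIdealSum_true]
  refine idealSum_chain ground rel w f M (posetGround e) (posetRel e) (e u) (e u)
    (by simp [posetGround]) (by simp [posetGround]) ?_ hf ?_ hground hrel
  · rintro _ _ ⟨x, y, -, rfl, rfl⟩
    simp [posetGround]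
  · intro i hi h
    obtain ⟨x, -, hx⟩ := Finset.mem_image.1 h
    exact hfe i hi x hx.symm

/-- The ideal sum of a chain with two tails, one attached to each of its ends. -/
theorem idealSum_arc {α K P Q : Type*} [CommSemiring K] [Fintype P] [PartialOrder P]
    [Fintype Q] [PartialOrder Q]
    (ground : Finset α) (rel : α → α → Prop) (w : α → K) (f : ℕ → α) (M : ℕ)
    (e : P → α) (e' : Q → α) (u : P) (v : Q)
    (hf : ∀ i ≤ M, ∀ j ≤ M, f i = f j → i = j) (hfe : ∀ i ≤ M, ∀ x, f i ≠ e x)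
    (hfe' : ∀ i ≤ M, ∀ x, f i ≠ e' x) (hee' : ∀ x y, e x ≠ e' y)
    (hground : ∀ x, x ∈ ground ↔
      (∃ i ≤ M, x = f i) ∨ x ∈ posetGround e ∨ x ∈ posetGround e')
    (hrel : ∀ x y, rel x y ↔ (∃ i < M, x = f i ∧ y = f (i + 1)) ∨
      (posetRel e x y ∨ posetRel e' x y) ∨ (x = f 0 ∧ y = e u) ∨ (x = e' v ∧ y = f M))
    (p₀ p₁ q₀ q₁ : K)
    (hp₀ : p₀ = restrictedIdealSum (posetGround e) (posetRel e) w (fun S => e u ∉ S))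
    (hp₁ : p₁ = restrictedIdealSum (posetGround e) (posetRel e) w (fun S => e u ∈ S))
    (hq₀ : q₀ = restrictedIdealSum (posetGround e') (posetRel e') w (fun S => e' v ∉ S))
    (hq₁ : q₁ = restrictedIdealSum (posetGround e') (posetRel e') w (fun S => e' v ∈ S)) :
    idealSum ground rel w =
      chainSum (fun j => w (f j)) M (p₀ * (q₀ + q₁)) ((p₀ + p₁) * (q₀ + q₁))
        ((p₀ + p₁) * q₁) := by
  have hdisj : Disjoint (posetGround e) (posetGround e') := by
    rw [Finset.disjoint_left]
    intro z hz hz'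
    obtain ⟨x, -, rfl⟩ := Finset.mem_image.1 hz
    obtain ⟨y, -, hy⟩ := Finset.mem_image.1 hz'
    exact hee' x y hy.symm
  have hR : ∀ x y, posetRel e x y → x ∈ posetGround e ∧ y ∈ posetGround e := by
    rintro _ _ ⟨x, y, -, rfl, rfl⟩
    simp [posetGround]
  have hR' : ∀ x y, posetRel e' x y → x ∈ posetGround e' ∧ y ∈ posetGround e' := by
    rintro _ _ ⟨x, y, -, rfl, rfl⟩
    simp [posetGround]
  have hu : e u ∈ posetGround e := by simp [posetGround]
  have hv : e' v ∈ posetGround e' := by simp [posetGround]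
  subst hp₀ hp₁ hq₀ hq₁
  rw [← restrictedIdealSum_true, ← restrictedIdealSum_true]
  rw [idealSum_chain ground rel w f M (posetGround e ∪ posetGround e')
    (posetRel e ⊔ posetRel e') (e u) (e' v) (Finset.mem_union_left _ hu)
    (Finset.mem_union_right _ hv) ?_ hf ?_ (by simpa using hground) (by simpa using hrel)]
  · congr 1
    · refine restrictedIdealSum_union _ _ _ _ w _ _ _ hdisj hR hR' fun U hU V hV => ?_
      have : e u ∉ V := fun h => Finset.disjoint_left.1 hdisj hu (hV h)
      simp [this]
    · exact restrictedIdealSum_union _ _ _ _ w _ _ _ hdisj hR hR' fun U hU V hV => by simp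
    · refine restrictedIdealSum_union _ _ _ _ w _ _ _ hdisj hR hR' fun U hU V hV => ?_
      have : e' v ∉ U := fun h => Finset.disjoint_left.1 hdisj (hU h) hv
      simp [this]
  · rintro x y (h | h)
    · exact ⟨Finset.mem_union_left _ (hR x y h).1, Finset.mem_union_left _ (hR x y h).2⟩
    · exact ⟨Finset.mem_union_right _ (hR' x y h).1, Finset.mem_union_right _ (hR' x y h).2⟩
  · intro i hi h
    rcases Finset.mem_union.1 h with h | h
    · obtain ⟨x, -, hx⟩ := Finset.mem_image.1 h
      exact hfe i hi x hx.symm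
    · obtain ⟨x, -, hx⟩ := Finset.mem_image.1 h
      exact hfe' i hi x hx.symm

theorem mem_natGround {α : Type*} (f : ℕ → α) (lo M : ℕ) (x : α) :
    x ∈ natGround f lo (lo + M) ↔ ∃ i ≤ M, x = f (lo + i) := by
  simp only [natGround, Finset.mem_image, Finset.mem_Icc]
  constructor
  · rintro ⟨j, hj, rfl⟩
    exact ⟨j - lo, by omega, by rw [Nat.add_sub_cancel' hj.1]⟩
  · rintro ⟨i, hi, rfl⟩
    exact ⟨lo + i, by omega, rfl⟩

theorem chainRel_iff {α : Type*} (f : ℕ → α) (lo M : ℕ) (x y : α) :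
    chainRel f lo (lo + M) x y ↔ ∃ i < M, x = f (lo + i) ∧ y = f (lo + (i + 1)) := by
  constructor
  · rintro ⟨j, h1, h2, rfl, rfl⟩
    exact ⟨j - lo, by omega, by congr 1; omega, by congr 1; omega⟩
  · rintro ⟨i, hi, rfl, rfl⟩
    exact ⟨lo + i, by omega, by omega, rfl, rfl⟩

theorem add_mod_injective (o M i j : ℕ) (hi : i ≤ M) (hj : j ≤ M)
    (h : (o + i) % (M + 1) = (o + j) % (M + 1)) : i = j :=
  Nat.ModEq.eq_of_lt_of_lt (Nat.ModEq.add_left_cancel' o h) (by omega) (by omega)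

theorem exists_add_mod_eq (o M j : ℕ) (hj : j ≤ M) : ∃ i ≤ M, (o + i) % (M + 1) = j := by
  have hinj : Function.Injective fun i : Fin (M + 1) =>
      (⟨(o + i) % (M + 1), Nat.mod_lt _ M.succ_pos⟩ : Fin (M + 1)) := fun i i' h =>
    Fin.ext (add_mod_injective o M i i' (by omega) (by omega) (Fin.mk.inj_iff.1 h))
  obtain ⟨i, hi⟩ := Finite.surjective_of_injective hinj ⟨j, by omega⟩
  exact ⟨i, by omega, Fin.mk.inj_iff.1 hi⟩

/-- A full turn through the spokes, starting anywhere, meets all of them. -/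
theorem mem_natGround_cyclic {α : Type*} (f : ℕ → α) (o M : ℕ) (x : α) :
    x ∈ natGround f 1 (M + 1) ↔ ∃ i ≤ M, x = f ((o + i) % (M + 1) + 1) := by
  rw [add_comm M 1, mem_natGround]
  constructor
  · rintro ⟨j, hj, rfl⟩
    obtain ⟨i, hi, h⟩ := exists_add_mod_eq o M j hj
    exact ⟨i, hi, by rw [add_comm 1 M, h, add_comm]⟩
  · rintro ⟨i, -, rfl⟩
    exact ⟨(o + i) % (M + 1), Nat.lt_succ_iff.1 (Nat.mod_lt _ M.succ_pos),
      by rw [add_comm 1 M, add_comm 1]⟩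

theorem skein_type1_grafting_notched
    (K : Type*) [CommSemiring K]
    (m W r k ℓ : ℕ) (hm : 2 ≤ m) (hW : 2 ≤ W) (hr1 : 1 ≤ r) (hr2 : r ≤ W - 1)
    (hk1 : 1 ≤ k) (hk2 : k ≤ m) (hl1 : 1 ≤ ℓ) (hl2 : ℓ ≤ m)
    (A B D : Type*)
    [Fintype A] [PartialOrder A] [Fintype B] [PartialOrder B]
    [Fintype D] [PartialOrder D]
    (a : A) (b : B) (d : D)
    (s : ℕ → K) (wA : A → K) (wB : B → K) (wD : D → K) :
    -- Z(P₁) · Z(P₂)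
    idealSum
        (posetGround (eA A B D) ∪
          natGround (eC A B D) 1 ((W - 1) * m + (ℓ + m - k) % m + 1) ∪
          posetGround (eB A B D))
        (posetRel (eA A B D) ⊔ posetRel (eB A B D) ⊔
          chainRel (eC A B D) 1 ((W - 1) * m + (ℓ + m - k) % m + 1) ⊔
          covRel (eC A B D 1) (eA A B D a) ⊔
          covRel (eB A B D b) (eC A B D ((W - 1) * m + (ℓ + m - k) % m + 1)))
        (Sum.elim wA (Sum.elim wB (Sum.elim wD
          (Sum.elim s (fun j => s ((k + j - 2) % m + 1)))))) *
      idealSum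
        (natGround (eS A B D) 1 m ∪ posetGround (eD A B D))
        (chainRel (eS A B D) 1 m ⊔ posetRel (eD A B D) ⊔
          covRel (eS A B D 1) (eD A B D d) ⊔ covRel (eD A B D d) (eS A B D m))
        (Sum.elim wA (Sum.elim wB (Sum.elim wD
          (Sum.elim s (fun j => s ((k + j - 2) % m + 1))))))
    -- = Z(P₃) · Z(P₄) + Y · Z(P₅) · Z(P₆)
    = idealSum
        (natGround (eC A B D) ((r - 1) * m + (m - k + 1) + 1)
            ((W - 1) * m + (ℓ + m - k) % m + 1) ∪
          posetGround (eD A B D) ∪ posetGround (eB A B D))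
        (chainRel (eC A B D) ((r - 1) * m + (m - k + 1) + 1)
            ((W - 1) * m + (ℓ + m - k) % m + 1) ⊔
          posetRel (eD A B D) ⊔ posetRel (eB A B D) ⊔
          covRel (eC A B D ((r - 1) * m + (m - k + 1) + 1)) (eD A B D d) ⊔
          covRel (eB A B D b) (eC A B D ((W - 1) * m + (ℓ + m - k) % m + 1)))
        (Sum.elim wA (Sum.elim wB (Sum.elim wD
          (Sum.elim s (fun j => s ((k + j - 2) % m + 1)))))) *
      idealSum
        (natGround (eS A B D) 1 m ∪ posetGround (eA A B D))
        (chainRel (fun j => eS A B D ((k + j - 2) % m + 1)) 1 m ⊔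
          posetRel (eA A B D) ⊔
          covRel (eS A B D k) (eA A B D a) ⊔
          covRel (eA A B D a) (eS A B D ((k + m - 2) % m + 1)))
        (Sum.elim wA (Sum.elim wB (Sum.elim wD
          (Sum.elim s (fun j => s ((k + j - 2) % m + 1))))))
      + (∏ j ∈ Finset.Icc ((r - 1) * m + (m - k + 1) + 1)
            ((W - 1) * m + (ℓ + m - k) % m + 1), s ((k + j - 2) % m + 1)) *
        (idealSum
            (posetGround (eA A B D) ∪
              natGround (eC A B D) 1 ((r - 1) * m + (m - k + 1)) ∪
              posetGround (eD A B D))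
            (posetRel (eA A B D) ⊔ posetRel (eD A B D) ⊔
              chainRel (eC A B D) 1 ((r - 1) * m + (m - k + 1)) ⊔
              covRel (eC A B D 1) (eA A B D a) ⊔
              covRel (eD A B D d) (eC A B D ((r - 1) * m + (m - k + 1))))
            (Sum.elim wA (Sum.elim wB (Sum.elim wD
              (Sum.elim s (fun j => s ((k + j - 2) % m + 1)))))) *
          idealSum
            (natGround (eS A B D) 1 m ∪ posetGround (eB A B D))
            (chainRel (fun j => eS A B D ((ℓ + j - 1) % m + 1)) 1 m ⊔
              posetRel (eB A B D) ⊔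
              covRel (eS A B D (ℓ % m + 1)) (eB A B D b) ⊔
              covRel (eB A B D b) (eS A B D ℓ))
            (Sum.elim wA (Sum.elim wB (Sum.elim wD
              (Sum.elim s (fun j => s ((k + j - 2) % m + 1))))))) := by
  obtain ⟨M, rfl⟩ : ∃ M, m = M + 1 := ⟨m - 1, by omega⟩
  obtain ⟨o, rfl⟩ : ∃ o, k = o + 1 := ⟨k - 1, by omega⟩
  have hstart : ∀ j, (o + 1 + (1 + j) - 2) % (M + 1) = (o + j) % (M + 1) := fun j => by
    congr 1; omega
  have hlast : ∀ j, (ℓ + (1 + j) - 1) % (M + 1) = (ℓ + j) % (M + 1) := fun j => by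
    congr 1; omega
  obtain ⟨c, hc⟩ : ∃ c, (r - 1) * (M + 1) + (M + 1 - (o + 1) + 1) = c + 1 := ⟨_, rfl⟩
  have hmod : ∀ j, (o + (c + 1) + j) % (M + 1) = j % (M + 1) := fun j => by
    have : o + (c + 1) + j = j + r * (M + 1) := by
      obtain ⟨r, rfl⟩ : ∃ r', r = r' + 1 := ⟨r - 1, by omega⟩
      rw [← hc, Nat.add_sub_cancel, add_mul]
      omega
    rw [this, Nat.add_mul_mod_self_right]
  have hlt : c + 1 ≤ (W - 1) * (M + 1) + (ℓ + (M + 1) - (o + 1)) % (M + 1) := by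
    obtain ⟨r, rfl⟩ : ∃ r', r = r' + 1 := ⟨r - 1, by omega⟩
    have := Nat.mul_le_mul_right (M + 1) hr2
    rw [add_mul] at this
    rw [Nat.add_sub_cancel] at hc
    omega
  obtain ⟨n, hn⟩ : ∃ n, (W - 1) * (M + 1) + (ℓ + (M + 1) - (o + 1)) % (M + 1) + 1 =
      1 + (c + 1 + n) := by
    obtain ⟨n, hn⟩ := Nat.exists_eq_add_of_le hlt
    exact ⟨n, by omega⟩
  have hmod' : ∀ j, (o + (c + 1) + (n + 1) + j) % (M + 1) = (ℓ + j) % (M + 1) := fun j => by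
    have : o + (c + 1) + (n + 1) + j ≡ ℓ + j [MOD M + 1] := by
      have e : o + (c + 1) + (n + 1) + j =
          (o + 1 + (ℓ + (M + 1) - (o + 1)) % (M + 1) + j) + (W - 1) * (M + 1) := by omega
      rw [e, Nat.ModEq, Nat.add_mul_mod_self_right]
      refine Nat.ModEq.add_right j (((Nat.mod_modEq _ _).add_left (o + 1)).trans ?_)
      rw [Nat.add_sub_cancel' (by omega)]
      simp [Nat.ModEq]
    exact this
  have key := chainSum_grafting (fun i => s (i + 1)) M o c n
  rw [hc, hn]
  have eC_inj : ∀ i j, eC A B D i = eC A B D j → i = j := fun i j h => by simpa [eC] using h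
  have eS_inj : ∀ i j, eS A B D i = eS A B D j → i = j := fun i j h => by simpa [eS] using h
  have hN : 1 + (c + 1 + n) = c + 1 + 1 + n := by omega
  have hM : M + 1 = 1 + M := by omega
  have hY : ∏ j ∈ Finset.Icc (c + 1 + 1) (1 + (c + 1 + n)), s ((o + 1 + j - 2) % (M + 1) + 1) =
      ∏ j ∈ Finset.range (n + 1), s ((o + (c + 1) + j) % (M + 1) + 1) := by
    rw [← Finset.Ico_add_one_right_eq_Icc, Finset.prod_Ico_eq_prod_range]
    refine Finset.prod_congr (by congr 1; omega) fun j _ => ?_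
    congr 3; omega
  rw [hY,
    idealSum_arc _ _ _ (fun i => eC A B D (1 + i)) (c + 1 + n) (eA A B D) (eB A B D) a b
      (fun i _ j _ h => by simpa using eC_inj _ _ h) (by simp [eC, eA]) (by simp [eC, eB])
      (by simp [eA, eB])
      (fun x => by simp only [Finset.mem_union, mem_natGround]; exact iff_of_eq (by ac_rfl))
      (fun x y => by simp only [Pi.sup_apply, sup_Prop_eq, chainRel_iff, covRel, add_zero]; exact iff_of_eq (by ac_rfl))
      _ _ _ _ rfl rfl rfl rfl,
    idealSum_loop _ _ _ (fun i => eS A B D (1 + i)) M (eD A B D) d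
      (fun i _ j _ h => by simpa using eS_inj _ _ h) (by simp [eS, eD])
      (fun x => by rw [hM]; simp only [Finset.mem_union, mem_natGround])
      (fun x y => by
        rw [hM]; simp only [Pi.sup_apply, sup_Prop_eq, chainRel_iff, covRel, add_zero]; exact iff_of_eq (by ac_rfl)),
    idealSum_arc _ _ _ (fun i => eC A B D (c + 1 + 1 + i)) n (eD A B D) (eB A B D) d b
      (fun i _ j _ h => by simpa using eC_inj _ _ h) (by simp [eC, eD]) (by simp [eC, eB])
      (by simp [eD, eB])
      (fun x => by rw [hN]; simp only [Finset.mem_union, mem_natGround]; exact iff_of_eq (by ac_rfl))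
      (fun x y => by
        rw [hN]; simp only [Pi.sup_apply, sup_Prop_eq, chainRel_iff, covRel, add_zero]; exact iff_of_eq (by ac_rfl))
      _ _ _ _ rfl rfl rfl rfl,
    idealSum_loop _ _ _ (fun i => eS A B D ((o + i) % (M + 1) + 1)) M (eA A B D) a
      (fun i hi j hj h => add_mod_injective o M i j hi hj (by simpa using eS_inj _ _ h))
      (by simp [eS, eA])
      (fun x => by simp only [Finset.mem_union, mem_natGround_cyclic _ o])
      (fun x y => by
        have h0 : (o + 0) % (M + 1) + 1 = o + 1 := by rw [add_zero, Nat.mod_eq_of_lt (by omega)]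
        have h1 : (o + 1 + (M + 1) - 2) % (M + 1) = (o + M) % (M + 1) := by congr 1; omega
        rw [h1, h0]
        have := chainRel_iff (fun j => eS A B D ((o + 1 + j - 2) % (M + 1) + 1)) 1 M x y
        simp only [hstart] at this
        rw [← hM] at this
        simp only [Pi.sup_apply, sup_Prop_eq, this, covRel]; exact iff_of_eq (by ac_rfl)),
    idealSum_arc _ _ _ (fun i => eC A B D (1 + i)) c (eA A B D) (eD A B D) a d
      (fun i _ j _ h => by simpa using eC_inj _ _ h) (by simp [eC, eA]) (by simp [eC, eD])
      (by simp [eA, eD])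
      (fun x => by rw [add_comm c 1]; simp only [Finset.mem_union, mem_natGround]; exact iff_of_eq (by ac_rfl))
      (fun x y => by
        rw [add_comm c 1]
        simp only [Pi.sup_apply, sup_Prop_eq, chainRel_iff, covRel, add_zero]; exact iff_of_eq (by ac_rfl))
      _ _ _ _ rfl rfl rfl rfl,
    idealSum_loop _ _ _ (fun i => eS A B D ((ℓ + i) % (M + 1) + 1)) M (eB A B D) b
      (fun i hi j hj h => add_mod_injective ℓ M i j hi hj (by simpa using eS_inj _ _ h))
      (by simp [eS, eB])
      (fun x => by simp only [Finset.mem_union, mem_natGround_cyclic _ ℓ])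
      (fun x y => by
        have h1 : (ℓ + M) % (M + 1) + 1 = ℓ := by
          rw [show ℓ + M = ℓ - 1 + (M + 1) by omega, Nat.add_mod_right,
            Nat.mod_eq_of_lt (by omega)]
          omega
        rw [h1, add_zero]
        have := chainRel_iff (fun j => eS A B D ((ℓ + j - 1) % (M + 1) + 1)) 1 M x y
        simp only [hlast] at this
        rw [← hM] at this
        simp only [Pi.sup_apply, sup_Prop_eq, this, covRel]; exact iff_of_eq (by ac_rfl))]
  have hchain : ∀ j, (o + 1 + (c + 1 + 1 + j) - 2) % (M + 1) = (o + (c + 1) + j) % (M + 1) :=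
    fun j => by congr 1; omega
  rw [chainSum_congr (fun j => Sum.elim wA (Sum.elim wB (Sum.elim wD
      (Sum.elim s (fun j => s ((o + 1 + j - 2) % (M + 1) + 1))))) (eS A B D (1 + j))) (fun j => s ((o + (c + 1) + j) % (M + 1) + 1)) M _ _ _ fun j hj => by
    rw [hmod, Nat.mod_eq_of_lt (by omega), add_comm j 1]; rfl]
  simp only [hmod'] at key
  simp only [eC, eS, Sum.elim_inl, Sum.elim_inr, hstart, hchain]
  exact key _ _ _ _ _ _
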